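/- arXiv:2202.10042 — 4 statements merged into one kernel-verified Lean document; each statement's English description precedes it below -/
import Mathlib

section
/- Let N ≥ 1, let λ ∈ (0,1), let δ ≥ 0, and let ψ¹, ψ² ∈ ℝ^N satisfy |ψ¹_i − ψ²_i| ≤ δ for all i = 1, …, N. For α = 1, 2 define p^α by p^α_1 = ψ^α_1, p^α_{k+1} = λ·p^α_k + ψ^α_{k+1}, and q^α by q^α_N = 0, q^α_k = λ·(q^α_{k+1} + ψ^α_{k+1}). Then for every k = 1, …, N, |(p¹_k + q¹_k) − (p²_k + q²_k)| ≤ ((2 − (λ^k + λ^{N−k+1}))/(1 − λ) − 1)·δ; that is, the FS-1 recursive evaluation of the matrix-vector product Kψ satisfies the same stability bound as the direct summation in the Sinkhorn algorithm. -/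
/-- Stability of the FS-1 recursive evaluation of the matrix-vector product:
the forward-plus-backward sweeps satisfy the same stability bound
`((2 - (λ^k + λ^(N-k+1)))/(1 - λ) - 1) δ` as the direct summation in the
Sinkhorn algorithm. -/
theorem fs1_stability (N : ℕ) (hN : 1 ≤ N) (lam : ℝ)
    (hlam0 : 0 < lam) (hlam1 : lam < 1) (δ : ℝ) (hδ : 0 ≤ δ)
    (ψ1 ψ2 p1 p2 q1 q2 : ℕ → ℝ)
    (hψ : ∀ i, 1 ≤ i → i ≤ N → |ψ1 i - ψ2 i| ≤ δ)
    (hp1 : p1 1 = ψ1 1) (hp2 : p2 1 = ψ2 1)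
    (hprec1 : ∀ k, 1 ≤ k → k ≤ N - 1 → p1 (k + 1) = lam * p1 k + ψ1 (k + 1))
    (hprec2 : ∀ k, 1 ≤ k → k ≤ N - 1 → p2 (k + 1) = lam * p2 k + ψ2 (k + 1))
    (hq1N : q1 N = 0) (hq2N : q2 N = 0)
    (hqrec1 : ∀ k, 1 ≤ k → k ≤ N - 1 → q1 k = lam * (q1 (k + 1) + ψ1 (k + 1)))
    (hqrec2 : ∀ k, 1 ≤ k → k ≤ N - 1 → q2 k = lam * (q2 (k + 1) + ψ2 (k + 1))) :
    ∀ k, 1 ≤ k → k ≤ N →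
      |(p1 k + q1 k) - (p2 k + q2 k)| ≤
        ((2 - (lam ^ k + lam ^ (N - k + 1))) / (1 - lam) - 1) * δ := by
  have h1 : (1 - lam) ≠ 0 := by linarith
  have geo : ∀ m : ℕ, (1 - lam ^ (m + 1)) / (1 - lam)
      = lam * ((1 - lam ^ m) / (1 - lam)) + 1 := by
    intro m
    field_simp
    ring
  have hp : ∀ k, 1 ≤ k → k ≤ N → |p1 k - p2 k| ≤ (1 - lam ^ k) / (1 - lam) * δ := by
    intro k hk
    induction k, hk using Nat.le_induction with
    | base =>
      intro h
      rw [hp1, hp2, pow_one, div_self h1, one_mul]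
      exact hψ 1 le_rfl h
    | succ k hk ih =>
      intro h
      have ih' := ih (by omega)
      have hs := hψ (k + 1) (by omega) h
      rw [hprec1 k hk (by omega), hprec2 k hk (by omega), geo]
      rw [abs_le] at *
      constructor <;> nlinarith
  have hq : ∀ j, j + 1 ≤ N →
      |q1 (N - j) - q2 (N - j)| ≤ ((1 - lam ^ (j + 1)) / (1 - lam) - 1) * δ := by
    intro j
    induction j with
    | zero =>
      intro h
      simp [hq1N, hq2N, div_self h1]
    | succ j ih =>
      intro h
      have ih' := ih (by omega)
      have hs := hψ (N - j) (by omega) (by omega)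
      have e : N - (j + 1) + 1 = N - j := by omega
      rw [hqrec1 (N - (j + 1)) (by omega) (by omega),
        hqrec2 (N - (j + 1)) (by omega) (by omega), e, geo (j + 1)]
      rw [abs_le] at *
      constructor <;> nlinarith
  intro k hk hkN
  have a := hp k hk hkN
  have b := hq (N - k) (by omega)
  rw [show N - (N - k) = k by omega] at b
  have e : ((2 - (lam ^ k + lam ^ (N - k + 1))) / (1 - lam) - 1) * δ
      = (1 - lam ^ k) / (1 - lam) * δ + ((1 - lam ^ (N - k + 1)) / (1 - lam) - 1) * δ := by
    ring
  rw [e]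
  rw [abs_le] at *
  constructor <;> linarith [a.1, a.2, b.1, b.2]
end

section
/- Let N ≥ 1, h > 0, ε > 0, let u, v ∈ ℝ^N have nonnegative entries with Σ_i u_i = Σ_j v_j = 1, and let Γ be the set of N×N matrices γ with γ_{ij} ≥ 0, Σ_j γ_{ij} = u_i, Σ_i γ_{ij} = v_j. Suppose φ, ψ ∈ ℝ^N have strictly positive entries and the matrix γ* with entries γ*_{ij} = φ_i · e^{−|i−j|h/ε} · ψ_j belongs to Γ. Then γ* is a minimizer of F(γ) = Σ_{ij} (γ_{ij}|i−j|h + ε γ_{ij} ln γ_{ij}) (with 0·ln 0 = 0) over Γ. -/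
/-- Sufficiency of the Sinkhorn scaling form: if `γ*_{ij} = φ_i K_{ij} ψ_j`
with kernel `K_{ij} = e^{-|i-j|h/ε}` and positive scalings `φ, ψ`, and `γ*`
satisfies the marginal constraints, then `γ*` minimizes the entropy-regularized
discrete Wasserstein-1 objective over the transport polytope. -/
theorem sinkhorn_scaling_sufficiency (N : ℕ) (hN : 1 ≤ N)
    (h ε : ℝ) (hh : 0 < h) (hε : 0 < ε)
    (u v : Fin N → ℝ) (hu : ∀ i, 0 ≤ u i) (hv : ∀ j, 0 ≤ v j)
    (husum : ∑ i, u i = 1) (hvsum : ∑ j, v j = 1)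
    (φ ψ : Fin N → ℝ) (hφ : ∀ i, 0 < φ i) (hψ : ∀ j, 0 < ψ j)
    (γstar : Matrix (Fin N) (Fin N) ℝ)
    (hγstar : ∀ i j, γstar i j =
      φ i * Real.exp (-((((i : ℤ) - (j : ℤ)).natAbs : ℝ) * h) / ε) * ψ j)
    (hmargrow : ∀ i, ∑ j, γstar i j = u i)
    (hmargcol : ∀ j, ∑ i, γstar i j = v j) :
    ∀ γ : Matrix (Fin N) (Fin N) ℝ,
      ((∀ i j, 0 ≤ γ i j) ∧ (∀ i, ∑ j, γ i j = u i) ∧ (∀ j, ∑ i, γ i j = v j)) →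
      ∑ i : Fin N, ∑ j : Fin N,
          (γstar i j * ((((i : ℤ) - (j : ℤ)).natAbs : ℝ) * h) +
            ε * (γstar i j * Real.log (γstar i j))) ≤
        ∑ i : Fin N, ∑ j : Fin N,
          (γ i j * ((((i : ℤ) - (j : ℤ)).natAbs : ℝ) * h) +
            ε * (γ i j * Real.log (γ i j))) := by
  intro γ ⟨hpos, hrow, hcol⟩
  have key : ∀ i j : Fin N,
      (γstar i j * ((((i : ℤ) - (j : ℤ)).natAbs : ℝ) * h) +
            ε * (γstar i j * Real.log (γstar i j))) +
        ε * ((γ i j - γstar i j) * (Real.log (φ i) + 1)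
          + (γ i j - γstar i j) * Real.log (ψ j)) ≤
      (γ i j * ((((i : ℤ) - (j : ℤ)).natAbs : ℝ) * h) +
            ε * (γ i j * Real.log (γ i j))) := by
    intro i j
    have hs := hγstar i j
    have hg := hpos i j
    generalize ((((i : ℤ) - (j : ℤ)).natAbs : ℝ) * h) = c at *
    have hsp : 0 < γstar i j := by
      rw [hs]; exact mul_pos (mul_pos (hφ i) (Real.exp_pos _)) (hψ j)
    have hlog : Real.log (γstar i j) = Real.log (φ i) + -c / ε + Real.log (ψ j) := by
      rw [hs, Real.log_mul (mul_pos (hφ i) (Real.exp_pos _)).ne' (hψ j).ne',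
        Real.log_mul (hφ i).ne' (Real.exp_pos _).ne', Real.log_exp]
    have hc : c = ε * (Real.log (φ i) + Real.log (ψ j) - Real.log (γstar i j)) := by
      rw [hlog]; field_simp; ring
    have hk : γ i j * Real.log (γstar i j) + γ i j - γstar i j
        ≤ γ i j * Real.log (γ i j) := by
      rcases hg.eq_or_lt with h0 | h0
      · rw [← h0]; simp; exact hsp.le
      · have h1 := Real.log_le_sub_one_of_pos (div_pos hsp h0)
        rw [Real.log_div hsp.ne' h0.ne'] at h1
        have h2 := mul_le_mul_of_nonneg_left h1 hg
        have h3 : γ i j * (γstar i j / γ i j - 1) = γstar i j - γ i j := by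
          field_simp
        linarith
    have hk' := mul_le_mul_of_nonneg_left hk hε.le
    rw [hc]
    linarith
  have hsum := Finset.sum_le_sum fun i (_ : i ∈ Finset.univ) =>
    Finset.sum_le_sum fun j (_ : j ∈ Finset.univ) => key i j
  have hA : ∑ i : Fin N, ∑ j : Fin N, (γ i j - γstar i j) * (Real.log (φ i) + 1) = 0 := by
    refine Finset.sum_eq_zero fun i _ => ?_
    rw [← Finset.sum_mul, Finset.sum_sub_distrib, hrow, hmargrow, sub_self, zero_mul]
  have hB : ∑ i : Fin N, ∑ j : Fin N, (γ i j - γstar i j) * Real.log (ψ j) = 0 := by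
    rw [Finset.sum_comm]
    refine Finset.sum_eq_zero fun j _ => ?_
    rw [← Finset.sum_mul, Finset.sum_sub_distrib, hcol, hmargcol, sub_self, zero_mul]
  have hC : ∑ i : Fin N, ∑ j : Fin N, ε * ((γ i j - γstar i j) * (Real.log (φ i) + 1)
          + (γ i j - γstar i j) * Real.log (ψ j)) = 0 := by
    simp_rw [← Finset.mul_sum, Finset.sum_add_distrib]
    rw [hA, hB]; simp
  refine le_trans (le_of_eq ?_) hsum
  symm
  simp_rw [Finset.sum_add_distrib (f := fun j => γstar _ j * _ + _)]
  rw [Finset.sum_add_distrib, hC, add_zero]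
end

section
/- Let N ≥ 1, h, ε > 0, set λ = e^{−h/ε}, and let α, β, φ ∈ ℝ^N. Define r₁, …, r_N recursively by r₁ = e^{(α₁+β₁)/ε}·φ₁ and r_{i+1} = λ·e^{(β_{i+1}−β_i)/ε}·r_i + e^{(α_{i+1}+β_{i+1})/ε}·φ_{i+1} for i = 1, …, N−1. Then for every k = 1, …, N, r_k = Σ_{i=1}^{k} e^{(α_i + β_k − (k−i)h)/ε}·φ_i; that is, r_k equals the lower-triangular part of the k-th entry of the product of the rescaled kernel K̃_{ki} = e^{(α_i + β_k − |k−i|h)/ε} with φ. -/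
/-- Correctness of the forward sweep of the log-domain stabilized FS-1
algorithm: the recursion computes the lower-triangular part of the product of
the rescaled kernel `K̃_{ki} = e^{(α_i + β_k - |k-i| h)/ε}` with `φ`. -/
theorem fs1_forward_sweep_log_stabilized (N : ℕ) (hN : 1 ≤ N)
    (h ε : ℝ) (hh : 0 < h) (hε : 0 < ε) (lam : ℝ) (hlam : lam = Real.exp (-h / ε))
    (α β φ r : ℕ → ℝ)
    (hr1 : r 1 = Real.exp ((α 1 + β 1) / ε) * φ 1)
    (hrec : ∀ i, 1 ≤ i → i ≤ N - 1 →
      r (i + 1) = lam * Real.exp ((β (i + 1) - β i) / ε) * r i +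
        Real.exp ((α (i + 1) + β (i + 1)) / ε) * φ (i + 1)) :
    ∀ k, 1 ≤ k → k ≤ N →
      r k = ∑ i ∈ Finset.Icc 1 k,
        Real.exp ((α i + β k - ((k - i : ℕ) : ℝ) * h) / ε) * φ i := by
  intro k hk
  induction k, hk using Nat.le_induction with
  | base => intro _; simp [hr1]
  | succ k hk ih =>
    intro hkN
    rw [hrec k hk (by omega), ih (by omega), Finset.sum_Icc_succ_top (by omega), Finset.mul_sum]
    congr 1
    · refine Finset.sum_congr rfl fun i hi => ?_
      have hik := (Finset.mem_Icc.mp hi).2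
      rw [hlam, ← mul_assoc, ← Real.exp_add, ← Real.exp_add, Nat.cast_sub hik,
        Nat.cast_sub (by omega : i ≤ k + 1)]
      congr 2
      push_cast
      ring
    · simp
end

section
/- Let N ≥ 1, h, ε > 0, set λ = e^{−h/ε}, and let α, β, φ ∈ ℝ^N. Define s₁, …, s_N recursively by s_N = 0 and s_k = λ·e^{(β_k−β_{k+1})/ε}·(s_{k+1} + e^{(α_{k+1}+β_{k+1})/ε}·φ_{k+1}) for k = N−1, …, 1. Then for every k = 1, …, N, s_k = Σ_{i=k+1}^{N} e^{(α_i + β_k − (i−k)h)/ε}·φ_i; that is, s_k equals the strictly upper-triangular part of the k-th entry of the product of the rescaled kernel K̃_{ki} = e^{(α_i + β_k − |k−i|h)/ε} with φ. -/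
/-- Correctness of the backward sweep of the log-domain stabilized FS-1
algorithm: the recursion computes the strictly upper-triangular part of the
product of the rescaled kernel `K̃_{ki} = e^{(α_i + β_k - |k-i| h)/ε}` with
`φ`. -/
theorem fs1_backward_sweep_log_stabilized (N : ℕ) (hN : 1 ≤ N)
    (h ε : ℝ) (hh : 0 < h) (hε : 0 < ε) (lam : ℝ) (hlam : lam = Real.exp (-h / ε))
    (α β φ s : ℕ → ℝ)
    (hsN : s N = 0)
    (hrec : ∀ k, 1 ≤ k → k ≤ N - 1 →
      s k = lam * Real.exp ((β k - β (k + 1)) / ε) *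
        (s (k + 1) + Real.exp ((α (k + 1) + β (k + 1)) / ε) * φ (k + 1))) :
    ∀ k, 1 ≤ k → k ≤ N →
      s k = ∑ i ∈ Finset.Icc (k + 1) N,
        Real.exp ((α i + β k - ((i - k : ℕ) : ℝ) * h) / ε) * φ i := by
  intro k hk1 hkN
  induction hkN using Nat.decreasingInduction with
  | self => simp [hsN]
  | of_succ k hkN ih =>
    have hins : Finset.Icc (k + 1) N = insert (k + 1) (Finset.Icc (k + 1 + 1) N) := by
      ext x
      simp only [Finset.mem_Icc, Finset.mem_insert]
      omega
    rw [hrec k hk1 (by omega), ih (by omega), hins, Finset.sum_insert (by simp), mul_add,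
      Finset.mul_sum, add_comm]
    congr 1
    · rw [hlam, ← mul_assoc, ← Real.exp_add, ← Real.exp_add]
      congr 2
      have : k + 1 - k = 1 := by omega
      rw [this]
      push_cast
      ring
    · refine Finset.sum_congr rfl fun i hi => ?_
      rw [Finset.mem_Icc] at hi
      rw [hlam, ← mul_assoc, ← Real.exp_add, ← Real.exp_add]
      congr 2
      have : i - k = (i - (k + 1)) + 1 := by omega
      rw [this]
      push_cast
      ring
end
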